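/- Let H be a graded connected Hopf algebra over a field k of characteristic zero, α : H₁ → k a nonzero linear map, and q = q_α the associated inverse-factorial character. For h ∈ k define the linear form q^{*h} := Σ_{p≥0} binom(h,p) φ^{*p}, where φ := q − ε and φ^{*p} is the p-fold convolution power (on each element of H this sum is finite by conilpotence of the reduced coproduct). Then q^{*h} is an algebra character of H and q^{*h}(x) = h^{|x|} q(x) for every homogeneous x ∈ H. -/

import Mathlib

open TensorProduct

/-- Convolution product of two linear forms on a coalgebra. -/
noncomputable def conv {k H : Type*} [CommSemiring k] [Semiring H] [Bialgebra k H]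
    (f g : H →ₗ[k] k) : H →ₗ[k] k :=
  (LinearMap.mul' k k) ∘ₗ (TensorProduct.map f g) ∘ₗ Coalgebra.comul

/-- A grading making a Hopf (bi)algebra graded and connected: the product and the coproduct
respect the grading and the degree-zero part is spanned by the unit. -/
structure GradedConnected (k H : Type*) [CommSemiring k] [Semiring H] [Bialgebra k H] where
  grading : ℕ → Submodule k H
  internal : DirectSum.IsInternal grading
  connected : grading 0 = Submodule.span k {1}
  mul_mem : ∀ {p q : ℕ} {x y : H}, x ∈ grading p → y ∈ grading q → x * y ∈ grading (p + q)
  comul_mem : ∀ {n : ℕ} {x : H}, x ∈ grading n →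
    Coalgebra.comul (R := k) x ∈
      ⨆ p ∈ Finset.range (n + 1),
        LinearMap.range (TensorProduct.mapIncl (grading p) (grading (n - p)))


/-- Iterated convolution powers of a linear form, with `f^{*0} = ε` (the counit). -/
noncomputable def convPow {k H : Type*} [CommSemiring k] [Semiring H] [Bialgebra k H]
    (f : H →ₗ[k] k) : ℕ → (H →ₗ[k] k)
  | 0 => Coalgebra.counit
  | p + 1 => conv f (convPow f p)

/-- The binomial coefficient `binom(h, p) = h(h-1)⋯(h-p+1)/p!` in a field. -/
noncomputable def kbinom {k : Type*} [Field k] (h : k) (p : ℕ) : k :=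
  (∏ i ∈ Finset.range p, (h - (i : k))) / (p.factorial : k)

lemma gc_rep {k H : Type*} [Field k] [Ring H] [HopfAlgebra k H]
    (G : GradedConnected k H) {n : ℕ} {x : H} (hx : x ∈ G.grading n) :
    ∃ (N : ℕ) (a b : Fin N → H), Coalgebra.comul (R := k) x = ∑ i, a i ⊗ₜ[k] b i ∧
      (∀ i, ∃ p r, p + r = n ∧ a i ∈ G.grading p ∧ b i ∈ G.grading r) ∧
      x = ∑ i, Coalgebra.counit (R := k) (b i) • a i ∧
      x = ∑ i, Coalgebra.counit (R := k) (a i) • b i := by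
  have h1 : Coalgebra.comul (R := k) x ∈ Submodule.span k
      {t : H ⊗[k] H | ∃ a b p r, p + r = n ∧ a ∈ G.grading p ∧ b ∈ G.grading r ∧
        a ⊗ₜ[k] b = t} := by
    refine (iSup₂_le ?_ : (⨆ p ∈ Finset.range (n + 1),
        LinearMap.range (TensorProduct.mapIncl (G.grading p) (G.grading (n - p)))) ≤ _)
          (G.comul_mem hx)
    rintro p hp _ ⟨t, rfl⟩
    rw [Finset.mem_range] at hp
    induction t using TensorProduct.induction_on with
    | zero => simp
    | add s t hs ht => rw [map_add]; exact add_mem hs ht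
    | tmul a b =>
      apply Submodule.subset_span
      exact ⟨a, b, p, n - p, by omega, a.2, b.2, rfl⟩
  rw [Submodule.mem_span_set'] at h1
  obtain ⟨N, f, g, hfg⟩ := h1
  choose a b p r hpr ha hb hab using fun i => (g i).2
  have hc : Coalgebra.comul (R := k) x = ∑ i, (f i • a i) ⊗ₜ[k] b i := by
    rw [← hfg]
    refine Finset.sum_congr rfl fun i _ => ?_
    rw [← hab i, TensorProduct.smul_tmul']
  refine ⟨N, fun i => f i • a i, b, hc, fun i => ⟨p i, r i, hpr i,
    Submodule.smul_mem _ _ (ha i), hb i⟩, ?_, ?_⟩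
  · have := Coalgebra.lTensor_counit_comul (R := k) x
    rw [hc] at this
    have := congrArg (TensorProduct.rid k H) this
    simpa using this.symm
  · have := Coalgebra.rTensor_counit_comul (R := k) x
    rw [hc] at this
    have := congrArg (TensorProduct.lid k H) this
    simpa using this.symm

lemma conv_of_rep {k H : Type*} [Field k] [Ring H] [HopfAlgebra k H]
    {N : ℕ} {a b : Fin N → H} {x : H}
    (h : Coalgebra.comul (R := k) x = ∑ i, a i ⊗ₜ[k] b i) (f g : H →ₗ[k] k) :
    conv f g x = ∑ i, f (a i) * g (b i) := by
  simp [conv, h]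

lemma gc_zero {k H : Type*} [Field k] [Ring H] [HopfAlgebra k H]
    (G : GradedConnected k H) {x : H} (hx : x ∈ G.grading 0) : ∃ c : k, c • (1 : H) = x := by
  rw [G.connected] at hx
  exact Submodule.mem_span_singleton.1 hx

lemma convPow_eq {k H : Type*} [Field k] [Ring H] [HopfAlgebra k H]
    (f : H →ₗ[k] k) (n : ℕ) : WithConv.toConv (convPow f n) = (WithConv.toConv f) ^ n := by
  induction n with
  | zero => rfl
  | succ n ih => rw [pow_succ', ← ih]; rfl

lemma convPow_vanish {k H : Type*} [Field k] [Ring H] [HopfAlgebra k H]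
    (G : GradedConnected k H) (f : H →ₗ[k] k) (hf : f 1 = 0) (p : ℕ) :
    ∀ n < p, ∀ x ∈ G.grading n, convPow f p x = 0 := by
  induction p with
  | zero => intro n hn; omega
  | succ p ih =>
    intro n hn x hx
    obtain ⟨N, a, b, hab, hd, -, -⟩ := gc_rep G hx
    rw [convPow, conv_of_rep hab]
    refine Finset.sum_eq_zero fun i _ => ?_
    obtain ⟨s, r, hsr, ha, hb⟩ := hd i
    rcases Nat.eq_zero_or_pos s with rfl | hs
    · obtain ⟨c, hc⟩ := gc_zero G ha
      rw [← hc]; simp [hf]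
    · rw [ih r (by omega) _ hb, mul_zero]

lemma convPow_two_pow {k H : Type*} [Field k] [Ring H] [HopfAlgebra k H]
    (G : GradedConnected k H) (q : H →ₗ[k] k)
    (hqconv : ∀ n : ℕ, ∀ x ∈ G.grading n, conv q q x = 2 ^ n * q x) (j : ℕ) :
    ∀ n : ℕ, ∀ x ∈ G.grading n, convPow q (2 ^ j) x = (2 ^ j) ^ n * q x := by
  induction j with
  | zero =>
    intro n x hx
    have : convPow q (2 ^ 0) = q := by
      apply WithConv.toConv_injective
      rw [convPow_eq]; simp
    rw [this]; simp
  | succ j ih =>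
    intro n x hx
    have : convPow q (2 ^ (j + 1)) = conv (convPow q (2 ^ j)) (convPow q (2 ^ j)) := by
      apply WithConv.toConv_injective
      rw [convPow_eq, pow_succ, mul_two, pow_add, ← convPow_eq]; rfl
    obtain ⟨N, a, b, hab, hd, -, -⟩ := gc_rep G hx
    have h2 := hqconv n x hx
    rw [conv_of_rep hab] at h2
    rw [this, conv_of_rep hab, pow_succ, mul_pow, mul_assoc, ← h2, Finset.mul_sum]
    refine Finset.sum_congr rfl fun i _ => ?_
    obtain ⟨s, r, hsr, ha, hb⟩ := hd i
    rw [ih s _ ha, ih r _ hb, ← hsr, pow_add]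
    ring

lemma kbinom_nat {k : Type*} [Field k] [CharZero k] (m p : ℕ) :
    kbinom (m : k) p = (m.choose p : k) := by
  rw [kbinom, Nat.cast_choose_eq_descPochhammer_div, descPochhammer_eval_eq_prod_range]

lemma q_nat {k H : Type*} [Field k] [CharZero k] [Ring H] [HopfAlgebra k H]
    (G : GradedConnected k H) (q : H →ₗ[k] k) (hq1 : q 1 = 1)
    (m n : ℕ) (x : H) (hx : x ∈ G.grading n) :
    convPow q m x = ∑ p ∈ Finset.range (n + 1),
        kbinom (m : k) p * (convPow (q - Coalgebra.counit) p) x := by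
  have h0 : (q - Coalgebra.counit : H →ₗ[k] k) 1 = 0 := by simp [hq1]
  have h1 : convPow q m x = ∑ p ∈ Finset.range (m + 1),
        kbinom (m : k) p * (convPow (q - Coalgebra.counit) p) x := by
    have e : WithConv.toConv q = WithConv.toConv (q - Coalgebra.counit) + 1 := by
      rw [WithConv.toConv_sub]
      exact (sub_add_cancel _ _).symm
    have e2 : WithConv.toConv (convPow q m) = ∑ p ∈ Finset.range (m + 1),
        (m.choose p : k) • WithConv.toConv (convPow (q - Coalgebra.counit) p) := by
      rw [convPow_eq, e, (Commute.one_right _).add_pow]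
      refine Finset.sum_congr rfl fun p _ => ?_
      rw [convPow_eq, one_pow, mul_one, ← Nat.cast_comm, Nat.cast_smul_eq_nsmul, nsmul_eq_mul]
    have e3 : convPow q m = ∑ p ∈ Finset.range (m + 1),
        (m.choose p : k) • (convPow (q - Coalgebra.counit) p) := by
      have := congrArg WithConv.ofConv e2
      simpa using this
    rw [e3]
    simp [kbinom_nat]
  rw [h1]
  have A : ∀ M, n ≤ M → m ≤ M → ∑ p ∈ Finset.range (m + 1),
        kbinom (m : k) p * (convPow (q - Coalgebra.counit) p) x = ∑ p ∈ Finset.range (M + 1),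
        kbinom (m : k) p * (convPow (q - Coalgebra.counit) p) x := by
    intro M _ hM
    apply Finset.sum_subset
    · intro p; simp; omega
    · intro p _ hp
      simp at hp
      rw [kbinom_nat, Nat.choose_eq_zero_of_lt (by omega)]; simp
  rw [A (max n m) (by simp) (by simp)]
  symm
  apply Finset.sum_subset
  · intro p; simp; omega
  · intro p _ hp
    simp at hp
    rw [convPow_vanish G _ h0 p n (by omega) x hx, mul_zero]

lemma q_mul {k H : Type*} [Field k] [CharZero k] [Ring H] [HopfAlgebra k H]
    (G : GradedConnected k H) (q : H →ₗ[k] k) (hq1 : q 1 = 1)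
    (hqconv : ∀ n : ℕ, ∀ x ∈ G.grading n, conv q q x = 2 ^ n * q x) (K : ℕ) :
    ∀ n m, n + m = K → ∀ x ∈ G.grading n, ∀ y ∈ G.grading m, q (x * y) = q x * q y := by
  induction K using Nat.strong_induction_on with
  | _ K ih =>
  intro n m hnm x hx y hy
  rcases Nat.eq_zero_or_pos n with rfl | hn
  · obtain ⟨c, rfl⟩ := gc_zero G hx
    simp [hq1]
  rcases Nat.eq_zero_or_pos m with rfl | hm
  · obtain ⟨c, rfl⟩ := gc_zero G hy
    simp [hq1, mul_comm]
  let E : H →ₗ[k] H →ₗ[k] k :=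
    (LinearMap.mul k H).compr₂ q - (LinearMap.mul k k).compl₁₂ q q
  have hE : ∀ u v, E u v = q (u * v) - q u * q v := fun u v => by simp [E]
  have hz : ∀ u ∈ G.grading 0, ∀ v ∈ G.grading 0, q (u * v) =
      Coalgebra.counit (R := k) u * Coalgebra.counit (R := k) v ∧
      q u = Coalgebra.counit (R := k) u := by
    intro u hu v hv
    obtain ⟨c, rfl⟩ := gc_zero G hu
    obtain ⟨d, rfl⟩ := gc_zero G hv
    simp [hq1, mul_comm]
  obtain ⟨N, a, b, hab, hd, hx1, hx2⟩ := gc_rep G hx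
  obtain ⟨N', c, d, hcd, hd', hy1, hy2⟩ := gc_rep G hy
  have hxy : Coalgebra.comul (R := k) (x * y) =
      ∑ i, ∑ j, (a i * c j) ⊗ₜ[k] (b i * d j) := by
    rw [Bialgebra.comul_mul, hab, hcd, Finset.sum_mul_sum]
    simp
  have h1 : conv q q (x * y) = ∑ i, ∑ j, q (a i * c j) * q (b i * d j) := by
    simp [conv, hxy]
  have h2 := hqconv _ _ (G.mul_mem hx hy)
  have e1 : E x y = ∑ i, ∑ j, E (a i) (c j) *
      (Coalgebra.counit (R := k) (b i) * Coalgebra.counit (R := k) (d j)) := by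
    conv_lhs => rw [hx1, hy1]
    simp only [map_sum, LinearMap.sum_apply, map_smul, LinearMap.smul_apply, smul_eq_mul, Finset.mul_sum]
    rw [Finset.sum_comm]
    refine Finset.sum_congr rfl fun i _ => Finset.sum_congr rfl fun j _ => by ring
  have e2 : E x y = ∑ i, ∑ j, (Coalgebra.counit (R := k) (a i) *
      Coalgebra.counit (R := k) (c j)) * E (b i) (d j) := by
    conv_lhs => rw [hx2, hy2]
    simp only [map_sum, LinearMap.sum_apply, map_smul, LinearMap.smul_apply, smul_eq_mul, Finset.mul_sum]
    rw [Finset.sum_comm]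
    refine Finset.sum_congr rfl fun i _ => Finset.sum_congr rfl fun j _ => by ring
  have e3 : conv q q x * conv q q y = ∑ i, ∑ j, q (a i) * q (b i) * (q (c j) * q (d j)) := by
    rw [conv_of_rep hab, conv_of_rep hcd, Finset.sum_mul_sum]
  have key : conv q q (x * y) = conv q q x * conv q q y + E x y + E x y := by
    conv_rhs => rw [e3]; enter [2]; rw [e2]
    rw [e1, h1]
    simp only [← Finset.sum_add_distrib]
    refine Finset.sum_congr rfl fun i _ => Finset.sum_congr rfl fun j _ => ?_
    obtain ⟨s, r, hsr, ha, hb⟩ := hd i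
    obtain ⟨s', r', hsr', hc, hdj⟩ := hd' j
    have E0 : ∀ u v s t, s + t < K → u ∈ G.grading s → v ∈ G.grading t → E u v = 0 := by
      intro u v s t hst hu hv
      rw [hE, ih _ hst s t rfl u hu v hv, sub_self]
    by_cases c1 : s + s' = K
    · obtain rfl : r = 0 := by omega
      obtain rfl : r' = 0 := by omega
      rw [E0 (b i) (d j) 0 0 (by omega) hb hdj, (hz _ hb _ hdj).1, (hz _ hb _ hdj).2,
        (hz _ hdj _ hb).2, hE]
      ring
    · rw [E0 (a i) (c j) s s' (by omega) ha hc]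
      have e := E0 (a i) (c j) s s' (by omega) ha hc
      rw [hE, sub_eq_zero] at e
      rw [e]
      by_cases c2 : r + r' = K
      · obtain rfl : s = 0 := by omega
        obtain rfl : s' = 0 := by omega
        rw [(hz _ ha _ hc).2, (hz _ hc _ ha).2, hE]
        ring
      · have e' := E0 (b i) (d j) r r' (by omega) hb hdj
        rw [e']
        rw [hE, sub_eq_zero] at e'
        rw [e']
        ring
  rw [h2, hqconv _ _ hx, hqconv _ _ hy, hE] at key
  have h3 : ((2 : k) ^ (n + m) - 2) * (q (x * y) - q x * q y) = 0 := by
    rw [pow_add] at *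
    linear_combination key
  rcases mul_eq_zero.1 h3 with h4 | h4
  · exfalso
    have h5 : (2 : k) ^ (n + m) = 2 := sub_eq_zero.1 h4
    have h6 : 2 ^ (n + m) = 2 := by exact_mod_cast h5
    have : 2 ^ 2 ≤ 2 ^ (n + m) := Nat.pow_le_pow_right (by norm_num) (by omega)
    omega
  · exact sub_eq_zero.1 h4

/-- For any `h ∈ k`, the `h`-th convolution power
`q^{*h} = Σ_{p≥0} binom(h,p) (q-ε)^{*p}` of the inverse-factorial character (the sum being
finite on each element by conilpotence) is an algebra character and satisfies
`q^{*h}(x) = h^{|x|} q(x)` on homogeneous elements. -/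
theorem stmt3 {k H : Type*} [Field k] [CharZero k] [Ring H] [HopfAlgebra k H]
    (G : GradedConnected k H)
    (α : ↥(G.grading 1) →ₗ[k] k) (hα : α ≠ 0)
    (q : H →ₗ[k] k)
    (hq1 : q 1 = 1)
    (hqα : ∀ x : ↥(G.grading 1), q x = α x)
    (hqconv : ∀ n : ℕ, ∀ x ∈ G.grading n, conv q q x = 2 ^ n * q x)
    (h : k) (Q : H →ₗ[k] k)
    (hQ : ∀ x : H, ∃ M : ℕ, ∀ m : ℕ, M ≤ m →
      Q x = ∑ p ∈ Finset.range (m + 1),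
        kbinom h p * (convPow (q - Coalgebra.counit) p) x) :
    (∀ x y : H, Q (x * y) = Q x * Q y) ∧
      ∀ n : ℕ, ∀ x ∈ G.grading n, Q x = h ^ n * q x := by
  have hom : ∀ n : ℕ, ∀ x ∈ G.grading n, Q x = h ^ n * q x := by
    intro n x hx
    have h0 : (q - Coalgebra.counit : H →ₗ[k] k) 1 = 0 := by simp [hq1]
    obtain ⟨M, hM⟩ := hQ x
    have hQn : Q x = ∑ p ∈ Finset.range (n + 1),
        kbinom h p * (convPow (q - Coalgebra.counit) p) x := by
      rw [hM (max n M) (by simp)]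
      symm
      apply Finset.sum_subset
      · intro p; simp; omega
      · intro p _ hp
        simp at hp
        rw [convPow_vanish G _ h0 p n (by omega) x hx, mul_zero]
    let P : Polynomial k := ∑ p ∈ Finset.range (n + 1),
      descPochhammer k p * Polynomial.C ((p.factorial : k)⁻¹ *
        (convPow (q - Coalgebra.counit) p) x)
    have hP : ∀ t : k, P.eval t = ∑ p ∈ Finset.range (n + 1),
        kbinom t p * (convPow (q - Coalgebra.counit) p) x := by
      intro t
      simp only [P, Polynomial.eval_finsetSum, Polynomial.eval_mul, Polynomial.eval_C,
        descPochhammer_eval_eq_prod_range, kbinom]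
      refine Finset.sum_congr rfl fun p _ => by ring
    have hPR : P = Polynomial.X ^ n * Polynomial.C (q x) := by
      apply Polynomial.eq_of_infinite_eval_eq
      apply Set.infinite_of_injective_forall_mem (f := fun j : ℕ => ((2 ^ j : ℕ) : k))
      · intro i j hij
        exact Nat.pow_right_injective (le_refl 2) (Nat.cast_injective hij)
      · intro j
        simp only [Set.mem_ofPred_eq]
        rw [hP, ← q_nat G q hq1 _ n x hx, convPow_two_pow G q hqconv j n x hx]
        simp only [Polynomial.eval_mul, Polynomial.eval_pow, Polynomial.eval_X, Polynomial.eval_C, Nat.cast_pow, Nat.cast_ofNat]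
    rw [hQn, ← hP, hPR]
    simp only [Polynomial.eval_mul, Polynomial.eval_pow, Polynomial.eval_X, Polynomial.eval_C]
  refine ⟨?_, hom⟩
  have top : ∀ x : H, x ∈ ⨆ n, G.grading n := by
    intro x
    rw [G.internal.submodule_iSup_eq_top]; trivial
  intro x y
  induction top x using Submodule.iSup_induction' with
  | zero => simp
  | add u v _ _ hu hv => rw [add_mul, map_add, hu, hv, map_add, add_mul]
  | mem n x hx =>
    induction top y using Submodule.iSup_induction' with
    | zero => simp
    | add u v _ _ hu hv => rw [mul_add, map_add, hu, hv, map_add, mul_add]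
    | mem m y hy =>
      rw [hom _ _ (G.mul_mem hx hy), hom _ _ hx, hom _ _ hy,
        q_mul G q hq1 hqconv _ n m rfl x hx y hy, pow_add]
      ring
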